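/- Let n ≥ 3. There exists a constant c₁ > 0, depending only on n, p, q, such that for every nonnegative Borel measure σ on ℝⁿ finite on bounded sets, every x ∈ ℝⁿ, every t > 0, and every y ∈ ℝⁿ with |y − x| < t, one has W_Gσ(y) ≥ c₁ · ∫_t^∞ h( σ(B(x,s))/s^(n−1) ) ds. -/

import Mathlib

open MeasureTheory Metric Set
open scoped ENNReal

noncomputable def gfun (p q : ℝ) (t : ℝ≥0∞) : ℝ≥0∞ := t ^ (p - 1) + t ^ (q - 1)

noncomputable def ffun (p q γ : ℝ) (t : ℝ≥0∞) : ℝ≥0∞ :=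
  t ^ ((p - 1) * γ) + t ^ ((q - 1) * γ)

noncomputable def Ffun (p q γ : ℝ) (t : ℝ≥0∞) : ℝ≥0∞ :=
  t ^ ((p - 1) * γ + 1) / ENNReal.ofReal ((p - 1) * γ + 1)
    + t ^ ((q - 1) * γ + 1) / ENNReal.ofReal ((q - 1) * γ + 1)

/-- The Wolff-type potential `W_G σ(x) = ∫₀^∞ h(σ(B(x,t))/t^(n−1)) dt`,
where `h` is the inverse of `g`. -/
noncomputable def wolffG (n : ℕ) (h : ℝ≥0∞ → ℝ≥0∞)
    (σ : Measure (EuclideanSpace ℝ (Fin n))) (x : EuclideanSpace ℝ (Fin n)) : ℝ≥0∞ :=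
  ∫⁻ t in Set.Ioi (0 : ℝ), h (σ (ball x t) / ENNReal.ofReal t ^ (n - 1))

/-- The classical Wolff potential `W_s σ(x) = ∫₀^∞ (σ(B(x,t))/t^(n−1))^(1/(s−1)) dt`. -/
noncomputable def wolffS (n : ℕ) (s : ℝ)
    (σ : Measure (EuclideanSpace ℝ (Fin n))) (x : EuclideanSpace ℝ (Fin n)) : ℝ≥0∞ :=
  ∫⁻ t in Set.Ioi (0 : ℝ), (σ (ball x t) / ENNReal.ofReal t ^ (n - 1)) ^ (1 / (s - 1))

/-- Condition (A) on the measure σ. -/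
def condA (n : ℕ) (p q γ : ℝ) (σ : Measure (EuclideanSpace ℝ (Fin n))) : Prop :=
  ∀ s ∈ ({p, q} : Set ℝ),
    ∀ θ ∈ ({1 / (1 - γ), (p - 1) / (p - 1 - γ * (q - 1)),
            (q - 1) / (q - 1 - γ * (p - 1))} : Set ℝ),
      (∫⁻ x, Ffun p q γ ((wolffS n s σ x) ^ θ) ∂σ) < ⊤

theorem gfun_mono {p q : ℝ} (hp : 1 ≤ p) (hq : 1 ≤ q) : Monotone (gfun p q) := fun _ _ hab =>
  add_le_add (ENNReal.rpow_le_rpow hab (by linarith)) (ENNReal.rpow_le_rpow hab (by linarith))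

theorem gfun_mul_le {p q : ℝ} (hp : 1 ≤ p) (hpq : p ≤ q) {c : ℝ≥0∞} (hc : c ≤ 1) (t : ℝ≥0∞) :
    gfun p q (c * t) ≤ c ^ (p - 1) * gfun p q t := by
  unfold gfun
  rw [ENNReal.mul_rpow_of_nonneg _ _ (by linarith), ENNReal.mul_rpow_of_nonneg _ _ (by linarith),
    mul_add]
  exact add_le_add le_rfl
    (mul_le_mul_left (ENNReal.rpow_le_rpow_of_exponent_ge hc (by linarith)) _)

/-- A right inverse of a monotone map from a linear order is monotone. -/
theorem monotone_of_inverse {α β : Type*} [LinearOrder α] [PartialOrder β] {g : α → β} {h : β → α}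
    (hg : Monotone g) (hhg : Function.RightInverse h g) : Monotone h := by
  intro a b hab
  by_contra! hlt
  have hba := hg hlt.le
  rw [hhg, hhg] at hba
  exact hlt.ne' (congrArg h (le_antisymm hab hba))

/-- Scaling lower bound for the inverse of `gfun p q`. -/
theorem mul_le_inverse_gfun {p q : ℝ} (hp : 1 ≤ p) (hpq : p ≤ q) {h : ℝ≥0∞ → ℝ≥0∞}
    (hgh : Function.LeftInverse h (gfun p q)) (hhg : Function.RightInverse h (gfun p q))
    {c : ℝ≥0∞} (hc : c ≤ 1) (s : ℝ≥0∞) : c * h s ≤ h (c ^ (p - 1) * s) := by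
  have hle := monotone_of_inverse (gfun_mono hp (hp.trans hpq)) hhg
    (gfun_mul_le hp hpq hc (h s))
  rwa [hgh, hhg] at hle

/-- Dilation by `2` maps `(t, ∞)` into `(0, ∞)` and does not decrease length. -/
theorem setLIntegral_comp_two_mul_le (F : ℝ → ℝ≥0∞) {t : ℝ} (ht : 0 ≤ t) :
    ∫⁻ s in Ioi t, F (2 * s) ≤ ∫⁻ r in Ioi (0 : ℝ), F r := by
  have himage := lintegral_image_eq_lintegral_abs_deriv_mul (measurableSet_Ioi (a := t))
    (f := fun s : ℝ => 2 * s) (f' := fun _ => 2)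
    (fun s _ => by simpa using ((hasDerivAt_id s).const_mul (2 : ℝ)).hasDerivWithinAt)
    (fun a _ b _ hab => by simpa using hab) F
  calc ∫⁻ s in Ioi t, F (2 * s) ≤ ∫⁻ s in Ioi t, ENNReal.ofReal |2| * F (2 * s) := by
        refine lintegral_mono fun s => le_mul_of_one_le_left' ?_
        simp
    _ = ∫⁻ r in (fun s : ℝ => 2 * s) '' Ioi t, F r := himage.symm
    _ ≤ ∫⁻ r in Ioi (0 : ℝ), F r := by
        refine lintegral_mono_set ?_
        rintro _ ⟨s, hs, rfl⟩
        have : t < s := hs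
        show (0 : ℝ) < 2 * s
        linarith

/-- Lower bound for the Wolff potential at nearby points:
`W_Gσ(y) ≥ c₁ ∫_t^∞ h(σ(B(x,s))/s^(n−1)) ds` for `y ∈ B(x,t)`. -/
theorem wolff_nearby_lower_bound
    (n : ℕ) (hn : 3 ≤ n) (p q : ℝ) (hp : 1 < p) (hpq : p < q)
    (h : ℝ≥0∞ → ℝ≥0∞)
    (hgh : ∀ t, h (gfun p q t) = t) (hhg : ∀ s, gfun p q (h s) = s) :
    ∃ c₁ : ℝ, 0 < c₁ ∧
      ∀ σ : Measure (EuclideanSpace ℝ (Fin n)),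
        (∀ (x : EuclideanSpace ℝ (Fin n)) (r : ℝ), σ (ball x r) < ⊤) →
        ∀ (x : EuclideanSpace ℝ (Fin n)) (t : ℝ), 0 < t →
          ∀ y : EuclideanSpace ℝ (Fin n), dist y x < t →
            ENNReal.ofReal c₁ *
                (∫⁻ s in Set.Ioi t, h (σ (ball x s) / ENNReal.ofReal s ^ (n - 1))) ≤
              wolffG n h σ y := by
  set K : ℝ≥0∞ := 2 ^ (n - 1) with hK
  have hK_top : K ≠ ⊤ := by simp [hK]
  have hK_one : 1 ≤ K := one_le_pow₀ (by norm_num)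
  have hp_pos : 0 < p - 1 := by linarith
  set c : ℝ≥0∞ := K⁻¹ ^ (1 / (p - 1)) with hc
  have hc_one : c ≤ 1 :=
    ENNReal.rpow_le_one (ENNReal.inv_le_one.2 hK_one) (by positivity)
  have hc_top : c ≠ ⊤ := ne_top_of_le_ne_top ENNReal.one_ne_top hc_one
  have hc_zero : c ≠ 0 :=
    (ENNReal.rpow_pos (ENNReal.inv_pos.2 hK_top)
      (ne_top_of_le_ne_top ENNReal.one_ne_top (ENNReal.inv_le_one.2 hK_one))).ne'
  have hc_rpow : c ^ (p - 1) = K⁻¹ := by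
    rw [hc, ← ENNReal.rpow_mul, one_div_mul_cancel hp_pos.ne', ENNReal.rpow_one]
  have h_mono : Monotone h := monotone_of_inverse (gfun_mono hp.le (hp.trans hpq).le) hhg
  refine ⟨c.toReal, ENNReal.toReal_pos hc_zero hc_top, fun σ _ x t ht y hy => ?_⟩
  rw [ENNReal.ofReal_toReal hc_top, ← lintegral_const_mul' _ _ hc_top]
  refine (setLIntegral_mono' measurableSet_Ioi fun s hs => ?_).trans
    (setLIntegral_comp_two_mul_le _ ht.le)
  refine (mul_le_inverse_gfun hp.le hpq.le hgh hhg hc_one _).trans (h_mono ?_)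
  have hts : t < s := hs
  have hball : ball x s ⊆ ball y (2 * s) :=
    ball_subset_ball' (by rw [dist_comm]; linarith)
  rw [hc_rpow, ENNReal.ofReal_mul zero_le_two, mul_pow, ENNReal.ofReal_ofNat, ← hK,
    div_eq_mul_inv, div_eq_mul_inv, ENNReal.mul_inv (.inr (by finiteness)) (.inl hK_top),
    mul_left_comm]
  gcongr
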